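/- Let (c_k)_{k≥0} be a real sequence with ∑_{k=0}^∞ |c_k| < ∞ and semi-generating function c(θ) = ∑_{k=0}^∞ c_k e^{ikθ}, and set σ := max_{θ∈[0,2π)} |c(θ)|. Then for every n ≥ 1 and all real sequences (v_1,…,v_n) and (u_1,…,u_n), the lower triangular convolution bilinear form satisfies ∑_{i=1}^n ∑_{j=1}^i c_{i−j} v_j u_i ≤ σ·(∑_{i=1}^n v_i²)^{1/2}·(∑_{i=1}^n u_i²)^{1/2}. -/

import Mathlib

open Real Set

theorem integral_exp_I_int_mul (m : ℤ) :
    ∫ θ in (0:ℝ)..(2 * π), Complex.exp (Complex.I * m * θ) = if m = 0 then 2 * (π : ℂ) else 0 := by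
  split_ifs with h
  · simp [h]
  · have hm : Complex.I * (m : ℂ) ≠ 0 := mul_ne_zero Complex.I_ne_zero (by exact_mod_cast h)
    rw [integral_exp_mul_complex hm]
    have : Complex.I * (m : ℂ) * ((2 * π : ℝ) : ℂ) = m * (2 * π * Complex.I) := by
      push_cast; ring
    rw [this, Complex.exp_int_mul_two_pi_mul_I]
    simp

theorem norm_exp_I_int_mul (m : ℤ) (θ : ℝ) : ‖Complex.exp (Complex.I * m * θ)‖ = 1 := by
  have : Complex.I * (m : ℂ) * θ = ((m * θ : ℝ) : ℂ) * Complex.I := by push_cast; ring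
  rw [this, Complex.norm_exp_ofReal_mul_I]

theorem norm_exp_I_nat_mul (k : ℕ) (θ : ℝ) : ‖Complex.exp (Complex.I * k * θ)‖ = 1 := by
  simpa using norm_exp_I_int_mul k θ

/-- The semi-generating function of a real sequence. -/
noncomputable def semiGen (c : ℕ → ℝ) (θ : ℝ) : ℂ :=
  ∑' k : ℕ, (c k : ℂ) * Complex.exp (Complex.I * k * θ)

theorem continuous_semiGen {c : ℕ → ℝ} (hc : Summable fun k => |c k|) :
    Continuous (semiGen c) := by
  refine continuous_tsum (fun k => by fun_prop) hc fun k θ => ?_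
  rw [norm_mul, norm_exp_I_nat_mul]
  simp

theorem norm_semiGen_le {c : ℕ → ℝ} (hc : Summable fun k => |c k|) (θ : ℝ) :
    ‖semiGen c θ‖ ≤ ∑' k, |c k| := by
  refine tsum_of_norm_bounded hc.hasSum fun k => ?_
  rw [norm_mul, norm_exp_I_nat_mul]
  simp

theorem integral_semiGen_mul_exp {c : ℕ → ℝ} (hc : Summable fun k => |c k|) (i j : ℕ) :
    ∫ θ in (0:ℝ)..(2 * π), semiGen c θ * Complex.exp (Complex.I * ((j : ℤ) - i : ℤ) * θ) =
      if j ≤ i then 2 * (π : ℂ) * c (i - j) else 0 := by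
  have key := intervalIntegral.hasSum_integral_of_dominated_convergence
    (μ := MeasureTheory.volume) (a := 0) (b := 2 * π)
    (F := fun (k : ℕ) (θ : ℝ) => (c k : ℂ) * Complex.exp (Complex.I * ((k + j - i : ℤ) : ℂ) * θ))
    (f := fun θ => semiGen c θ * Complex.exp (Complex.I * ((j : ℤ) - i : ℤ) * θ))
    (fun k _ => |c k|)
    (fun k => Continuous.aestronglyMeasurable (by fun_prop))
    (fun k => by
      filter_upwards with θ _
      rw [norm_mul, norm_exp_I_int_mul]
      simp)
    (by filter_upwards with θ _ using hc)
    (by simp)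
    (by
      filter_upwards with θ _
      have hs : Summable fun k : ℕ => (c k : ℂ) * Complex.exp (Complex.I * k * θ) := by
        refine Summable.of_norm_bounded hc fun k => ?_
        rw [norm_mul, norm_exp_I_nat_mul]
        simp
      refine (hs.hasSum.mul_right
        (Complex.exp (Complex.I * ((j : ℤ) - i : ℤ) * θ))).congr_fun fun k => ?_
      rw [mul_assoc (c k : ℂ), ← Complex.exp_add]
      congr 2
      push_cast
      ring)
  rw [← key.tsum_eq]
  simp_rw [intervalIntegral.integral_const_mul, integral_exp_I_int_mul]
  split_ifs with h
  · rw [tsum_eq_single (i - j)]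
    · rw [if_pos (by omega)]
      ring
    · intro k hk
      rw [if_neg (by omega), mul_zero]
  · refine (tsum_congr fun k => ?_).trans tsum_zero
    rw [if_neg (by omega), mul_zero]

/-- The trigonometric polynomial with given real coefficients. -/
noncomputable def trigPoly {n : ℕ} (v : Fin n → ℝ) (θ : ℝ) : ℂ :=
  ∑ j, (v j : ℂ) * Complex.exp (Complex.I * (j : ℕ) * θ)

theorem continuous_trigPoly {n : ℕ} (v : Fin n → ℝ) : Continuous (trigPoly v) := by
  unfold trigPoly
  fun_prop

theorem integral_semiGen_mul_trigPoly {c : ℕ → ℝ} (hc : Summable fun k => |c k|) {n : ℕ}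
    (v u : Fin n → ℝ) :
    ∫ θ in (0:ℝ)..(2 * π), semiGen c θ * (trigPoly v θ * starRingEnd ℂ (trigPoly u θ)) =
      ((2 * π * ∑ i : Fin n, ∑ j ∈ Finset.Iic i, c ((i:ℕ) - (j:ℕ)) * v j * u i : ℝ) : ℂ) := by
  have expand (θ : ℝ) : semiGen c θ * (trigPoly v θ * starRingEnd ℂ (trigPoly u θ)) =
      ∑ i : Fin n, ∑ j : Fin n, ((v j : ℂ) * u i) *
        (semiGen c θ * Complex.exp (Complex.I * (((j : ℕ) : ℤ) - (i : ℕ) : ℤ) * θ)) := by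
    unfold trigPoly
    rw [map_sum, Finset.sum_mul_sum, Finset.sum_comm]
    simp only [Finset.mul_sum]
    refine Finset.sum_congr rfl fun i _ => Finset.sum_congr rfl fun j _ => ?_
    have : Complex.I * (((((j : ℕ) : ℤ) - (i : ℕ) : ℤ)) : ℂ) * θ =
        Complex.I * (j : ℕ) * θ + -Complex.I * (i : ℕ) * θ := by push_cast; ring
    rw [this, Complex.exp_add, map_mul, ← Complex.exp_conj]
    simp only [map_mul, Complex.conj_I, Complex.conj_ofReal, map_natCast]
    ring
  have hcont := continuous_semiGen hc
  simp_rw [expand]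
  rw [intervalIntegral.integral_finsetSum
    fun i _ => Continuous.intervalIntegrable (by fun_prop) _ _]
  simp only [Complex.ofReal_mul, Complex.ofReal_sum, Complex.ofReal_ofNat]
  rw [Finset.mul_sum]
  refine Finset.sum_congr rfl fun i _ => ?_
  rw [intervalIntegral.integral_finsetSum
    fun i _ => Continuous.intervalIntegrable (by fun_prop) _ _]
  simp_rw [intervalIntegral.integral_const_mul, integral_semiGen_mul_exp hc]
  rw [Finset.mul_sum, ← Finset.sum_subset (Finset.subset_univ (Finset.Iic i))]
  · refine Finset.sum_congr rfl fun j hj => ?_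
    rw [if_pos (by simpa using hj)]
    ring
  · intro j _ hj
    rw [if_neg (by simpa using hj), mul_zero]

theorem integral_norm_sq_trigPoly {n : ℕ} (v : Fin n → ℝ) :
    ∫ θ in (0:ℝ)..(2 * π), ‖trigPoly v θ‖ ^ 2 = 2 * π * ∑ i, v i ^ 2 := by
  have hc : Summable fun k => |(Pi.single 0 1 : ℕ → ℝ) k| :=
    summable_of_ne_finset_zero (s := {0}) fun k hk => by
      rw [Pi.single_eq_of_ne (by simpa using hk), abs_zero]
  have hone (θ : ℝ) : semiGen (Pi.single 0 1) θ = 1 := by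
    unfold semiGen
    rw [tsum_eq_single 0 fun k hk => by simp [Pi.single_eq_of_ne hk]]
    simp
  have h := integral_semiGen_mul_trigPoly hc v v
  simp_rw [hone, one_mul, Complex.mul_conj'] at h
  have hsum : ∑ i : Fin n, ∑ j ∈ Finset.Iic i,
      (Pi.single 0 1 : ℕ → ℝ) ((i:ℕ) - (j:ℕ)) * v j * v i = ∑ i, v i ^ 2 := by
    refine Finset.sum_congr rfl fun i _ => ?_
    rw [Finset.sum_eq_single_of_mem i (by simp)]
    · simp [sq]
    · intro j hj hne
      have hlt : j < i := lt_of_le_of_ne (by simpa using hj) hne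
      rw [Pi.single_eq_of_ne (by omega)]
      simp
  rw [hsum] at h
  simp_rw [← Complex.ofReal_pow] at h
  rw [intervalIntegral.integral_ofReal] at h
  exact_mod_cast h

theorem two_mul_convolution_form_le {c : ℕ → ℝ} (hc : Summable fun k => |c k|) {σ : ℝ}
    (hσ : ∀ θ ∈ Ico (0:ℝ) (2 * π), ‖semiGen c θ‖ ≤ σ) {n : ℕ} (v u : Fin n → ℝ) :
    2 * ∑ i : Fin n, ∑ j ∈ Finset.Iic i, c ((i:ℕ) - (j:ℕ)) * v j * u i ≤
      σ * (∑ i, v i ^ 2 + ∑ i, u i ^ 2) := by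
  have hv := continuous_trigPoly v
  have hu := continuous_trigPoly u
  have hσ0 : 0 ≤ σ := (norm_nonneg _).trans (hσ 0 ⟨le_rfl, by positivity⟩)
  have hbound : ‖∫ θ in (0:ℝ)..(2 * π),
      semiGen c θ * (trigPoly v θ * starRingEnd ℂ (trigPoly u θ))‖ ≤
      ∫ θ in (0:ℝ)..(2 * π), σ / 2 * (‖trigPoly v θ‖ ^ 2 + ‖trigPoly u θ‖ ^ 2) := by
    refine intervalIntegral.norm_integral_le_of_norm_le (by positivity) ?_
      (Continuous.intervalIntegrable (by fun_prop) _ _)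
    filter_upwards [MeasureTheory.Measure.ae_ne MeasureTheory.volume (2 * π)] with θ hne hθ
    rw [norm_mul, norm_mul, RCLike.norm_conj]
    calc ‖semiGen c θ‖ * (‖trigPoly v θ‖ * ‖trigPoly u θ‖)
        ≤ σ * (‖trigPoly v θ‖ * ‖trigPoly u θ‖) := by
          gcongr
          exact hσ θ ⟨hθ.1.le, lt_of_le_of_ne hθ.2 hne⟩
      _ ≤ σ / 2 * (‖trigPoly v θ‖ ^ 2 + ‖trigPoly u θ‖ ^ 2) := by
          nlinarith [mul_nonneg hσ0 (sq_nonneg (‖trigPoly v θ‖ - ‖trigPoly u θ‖))]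
  rw [integral_semiGen_mul_trigPoly hc, Complex.norm_real, intervalIntegral.integral_const_mul,
    intervalIntegral.integral_add (Continuous.intervalIntegrable (by fun_prop) _ _)
      (Continuous.intervalIntegrable (by fun_prop) _ _),
    integral_norm_sq_trigPoly, integral_norm_sq_trigPoly] at hbound
  have h := (le_abs_self _).trans hbound
  refine le_of_mul_le_mul_left ?_ pi_pos
  linarith

/-- bound of the lower triangular convolution bilinear form
by the maximum modulus of the semi-generating function. -/
theorem stmt5 (c : ℕ → ℝ) (hsum : Summable fun k => |c k|)
    (σ : ℝ)
    (hσ : σ = sSup ((fun θ : ℝ =>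
        ‖∑' k : ℕ, (c k : ℂ) * Complex.exp (Complex.I * k * θ)‖) ''
        Set.Ico (0:ℝ) (2*π)))
    (n : ℕ) (hn : 1 ≤ n) (v u : Fin n → ℝ) :
    ∑ i : Fin n, ∑ j ∈ Finset.Iic i, c ((i:ℕ) - (j:ℕ)) * v j * u i ≤
      σ * Real.sqrt (∑ i : Fin n, (v i) ^ 2) * Real.sqrt (∑ i : Fin n, (u i) ^ 2) := by
  have hle : ∀ θ ∈ Ico (0:ℝ) (2 * π), ‖semiGen c θ‖ ≤ σ := by
    intro θ hθ
    rw [hσ]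
    refine le_csSup ⟨∑' k, |c k|, ?_⟩ ⟨θ, hθ, rfl⟩
    rintro _ ⟨φ, _, rfl⟩
    exact norm_semiGen_le hsum φ
  have eq_zero_of_sqrt {w : Fin n → ℝ} (h : √(∑ i, w i ^ 2) = 0) (i : Fin n) : w i = 0 := by
    rw [Real.sqrt_eq_zero (by positivity),
      Finset.sum_eq_zero_iff_of_nonneg fun _ _ => sq_nonneg _] at h
    simpa using h i (Finset.mem_univ i)
  have hva : √(∑ i, v i ^ 2) ^ 2 = ∑ i, v i ^ 2 := Real.sq_sqrt (by positivity)
  have hub : √(∑ i, u i ^ 2) ^ 2 = ∑ i, u i ^ 2 := Real.sq_sqrt (by positivity)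
  set a := √(∑ i, v i ^ 2) with ha
  set b := √(∑ i, u i ^ 2) with hb
  rcases (show 0 ≤ a from Real.sqrt_nonneg _).eq_or_lt with ha0 | ha0
  · simp [← ha0, eq_zero_of_sqrt (ha.symm.trans ha0.symm)]
  rcases (show 0 ≤ b from Real.sqrt_nonneg _).eq_or_lt with hb0 | hb0
  · simp [← hb0, eq_zero_of_sqrt (hb.symm.trans hb0.symm)]
  have h := two_mul_convolution_form_le hsum hle (fun i => b * v i) (fun i => a * u i)
  have hform : ∑ i : Fin n, ∑ j ∈ Finset.Iic i, c ((i:ℕ) - (j:ℕ)) * (b * v j) * (a * u i) =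
      a * b * ∑ i : Fin n, ∑ j ∈ Finset.Iic i, c ((i:ℕ) - (j:ℕ)) * v j * u i := by
    simp_rw [Finset.mul_sum]
    refine Finset.sum_congr rfl fun i _ => Finset.sum_congr rfl fun j _ => ?_
    ring
  simp_rw [hform, mul_pow, ← Finset.mul_sum, ← hva, ← hub] at h
  refine le_of_mul_le_mul_left ?_ (mul_pos ha0 hb0)
  linarith
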